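/- Let ξ ∈ ℂ be a primitive 7th root of unity. If (x, y, z) ∈ ℂ³ is nonzero and satisfies the three equations x³ = y²z, y³ = z²x, and z³ = x²y, then there exist λ ∈ ℂ with λ ≠ 0 and an integer i with 0 ≤ i ≤ 6 such that (x, y, z) = λ · (ξ^{3i}, ξ^i, 1); conversely every such triple satisfies the three equations. In particular, the common intersection in the complex projective plane of the three cuspidal cubic curves C₁ : x³ = y²z, C₂ : y³ = z²x, C₃ : z³ = x²y consists of exactly 7 points. -/

import Mathlib

open scoped LinearAlgebra.Projectivization

theorem exists_smul_of_cuspidal_cubics {ξ : ℂ} (hξ : IsPrimitiveRoot ξ 7) {x y z : ℂ}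
    (h0 : (x, y, z) ≠ (0 : ℂ × ℂ × ℂ))
    (h1 : x ^ 3 = y ^ 2 * z) (h2 : y ^ 3 = z ^ 2 * x) (h3 : z ^ 3 = x ^ 2 * y) :
    ∃ (l : ℂ) (i : ℕ), l ≠ 0 ∧ i ≤ 6 ∧
      (x, y, z) = l • ((ξ ^ (3 * i), ξ ^ i, 1) : ℂ × ℂ × ℂ) := by
  have hz : z ≠ 0 := by
    rintro rfl
    have hx : x = 0 := by simpa using h1
    have hy : y = 0 := by simpa using h2
    simp [hx, hy] at h0
  have hx : x = y ^ 3 / z ^ 2 := by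
    field_simp
    linear_combination -h2
  have ha : (y / z) ^ 7 = 1 := by
    rw [hx] at h3
    field_simp at h3 ⊢
    linear_combination -h3
  obtain ⟨i, hi, hia⟩ := hξ.eq_pow_of_pow_eq_one ha
  refine ⟨z, i, hz, by omega, ?_⟩
  have hxi : ξ ^ (3 * i) = (y / z) ^ 3 := by rw [mul_comm, pow_mul, hia]
  simp only [Prod.smul_mk, smul_eq_mul, hxi, hia, Prod.mk.injEq, mul_one, and_true]
  constructor
  · rw [hx]
    field_simp
  · field_simp

theorem cuspidal_cubics_of_pow_eq_one {a : ℂ} (ha : a ^ 7 = 1) (l : ℂ) :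
    (l * a ^ 3) ^ 3 = (l * a) ^ 2 * l ∧ (l * a) ^ 3 = l ^ 2 * (l * a ^ 3) ∧
      l ^ 3 = (l * a ^ 3) ^ 2 * (l * a) := by
  refine ⟨?_, by ring, ?_⟩
  · linear_combination l ^ 3 * a ^ 2 * ha
  · linear_combination -l ^ 3 * ha

/-- The common solutions of `x³ = y²z`, `y³ = z²x`, `z³ = x²y` are exactly the scalar
multiples of `(ξ^(3i), ξ^i, 1)` for `0 ≤ i ≤ 6`, where `ξ` is a primitive 7th root of
unity; in particular the intersection of the three cuspidal cubics in `ℂP²` consists of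
exactly 7 points. -/
theorem cuspidal_cubics_intersection (ξ : ℂ) (hξ : IsPrimitiveRoot ξ 7) :
    (∀ x y z : ℂ, (x, y, z) ≠ (0 : ℂ × ℂ × ℂ) →
      ((x ^ 3 = y ^ 2 * z ∧ y ^ 3 = z ^ 2 * x ∧ z ^ 3 = x ^ 2 * y) ↔
        ∃ (l : ℂ) (i : ℕ), l ≠ 0 ∧ i ≤ 6 ∧
          (x, y, z) = l • ((ξ ^ (3 * i), ξ ^ i, 1) : ℂ × ℂ × ℂ))) ∧
    Set.ncard {P : ℙ ℂ (ℂ × ℂ × ℂ) |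
      ∃ (x y z : ℂ) (h : (x, y, z) ≠ (0 : ℂ × ℂ × ℂ)),
        P = Projectivization.mk ℂ (x, y, z) h ∧
        x ^ 3 = y ^ 2 * z ∧ y ^ 3 = z ^ 2 * x ∧ z ^ 3 = x ^ 2 * y} = 7 := by
  have hpow (i : ℕ) : (ξ ^ i) ^ 7 = 1 := by rw [pow_right_comm, hξ.pow_eq_one, one_pow]
  have hne (i : ℕ) : ((ξ ^ (3 * i), ξ ^ i, 1) : ℂ × ℂ × ℂ) ≠ 0 := by simp
  have hmul (i : ℕ) : ξ ^ (3 * i) = (ξ ^ i) ^ 3 := by rw [mul_comm, pow_mul]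
  refine ⟨fun x y z h0 ↦ ⟨fun ⟨h1, h2, h3⟩ ↦ exists_smul_of_cuspidal_cubics hξ h0 h1 h2 h3, ?_⟩, ?_⟩
  · rintro ⟨l, i, -, -, h⟩
    simp only [Prod.smul_mk, smul_eq_mul, Prod.mk.injEq, mul_one, hmul] at h
    obtain ⟨rfl, rfl, rfl⟩ := h
    exact cuspidal_cubics_of_pow_eq_one (hpow i) _
  · have hset : {P : ℙ ℂ (ℂ × ℂ × ℂ) |
        ∃ (x y z : ℂ) (h : (x, y, z) ≠ (0 : ℂ × ℂ × ℂ)),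
          P = Projectivization.mk ℂ (x, y, z) h ∧
          x ^ 3 = y ^ 2 * z ∧ y ^ 3 = z ^ 2 * x ∧ z ^ 3 = x ^ 2 * y} =
        (fun i : ℕ ↦ Projectivization.mk ℂ _ (hne i)) '' (Finset.range 7 : Set ℕ) := by
      ext P
      constructor
      · rintro ⟨x, y, z, h0, rfl, h1, h2, h3⟩
        obtain ⟨l, i, -, hi, h⟩ := exists_smul_of_cuspidal_cubics hξ h0 h1 h2 h3
        refine ⟨i, by simpa using Nat.lt_succ_of_le hi, ?_⟩
        exact ((Projectivization.mk_eq_mk_iff' ℂ _ _ h0 (hne i)).2 ⟨l, h.symm⟩).symm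
      · rintro ⟨i, -, rfl⟩
        refine ⟨_, _, _, hne i, rfl, ?_⟩
        simpa [hmul] using cuspidal_cubics_of_pow_eq_one (hpow i) 1
    rw [hset, Set.InjOn.ncard_image, Set.ncard_coe_finset, Finset.card_range]
    intro i hi j hj hij
    obtain ⟨l, h⟩ := (Projectivization.mk_eq_mk_iff' ℂ _ _ (hne i) (hne j)).1 hij
    simp only [Prod.smul_mk, smul_eq_mul, Prod.mk.injEq, mul_one] at h
    obtain ⟨-, h, rfl⟩ := h
    rw [one_mul] at h
    exact hξ.pow_inj (by simpa using hi) (by simpa using hj) h.symm
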